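/- arXiv:1901.03874 — 9 statements merged into one kernel-verified Lean document; each statement's English description precedes it below -/
import Mathlib

section
/- Let T > 0, let r, R^A, R^B be real numbers, let λ > 0, and let U(x) = −exp(−x). Then the function F(p) = U(−e^{−rT} + p + e^{−R^A T}) + λ·U(e^{−rT} − p − e^{−R^B T}) is strictly concave on ℝ and attains its unique global maximum at p* = −(e^{−R^A T} + e^{−R^B T})/2 + e^{−rT} − ln(λ)/2; that is, F(p*) > F(p) for every p ≠ p*. -/
/-- Two agents with funding rates `RA`, `RB` trade a unit-notional bond of maturity `T`;
`r` is the OIS rate, `lam > 0` the bargaining power of agent B, `U x = -exp(-x)` the common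
exponential utility.  The aggregated utility `F` is strictly concave and is uniquely
maximized at `pstar = -(e^{-RA T} + e^{-RB T})/2 + e^{-r T} - ln(lam)/2`. -/
theorem stmt_0 (T r RA RB lam : ℝ) (hT : 0 < T) (hlam : 0 < lam)
    (U : ℝ → ℝ) (hU : ∀ x, U x = -Real.exp (-x))
    (F : ℝ → ℝ)
    (hF : ∀ p, F p = U (-Real.exp (-r * T) + p + Real.exp (-RA * T))
      + lam * U (Real.exp (-r * T) - p - Real.exp (-RB * T)))
    (pstar : ℝ)
    (hpstar : pstar = -(Real.exp (-RA * T) + Real.exp (-RB * T)) / 2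
      + Real.exp (-r * T) - Real.log lam / 2) :
    StrictConcaveOn ℝ Set.univ F ∧ ∀ p : ℝ, p ≠ pstar → F p < F pstar := by
  obtain ⟨C, hC, hFC⟩ : ∃ C : ℝ, 0 < C ∧
      ∀ p, F p = -(C * (Real.exp (-(p - pstar)) + Real.exp (p - pstar))) := by
    refine ⟨Real.exp (Real.exp (-r * T) - Real.exp (-RA * T) - pstar), Real.exp_pos _, ?_⟩
    intro p
    rw [hF, hU, hU, mul_add, ← Real.exp_add, ← Real.exp_add]
    have h2 : lam * -Real.exp (-(Real.exp (-r * T) - p - Real.exp (-RB * T)))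
        = -Real.exp (Real.log lam + -(Real.exp (-r * T) - p - Real.exp (-RB * T))) := by
      rw [Real.exp_add, Real.exp_log hlam]; ring
    rw [h2]
    have e1 : -(-Real.exp (-r * T) + p + Real.exp (-RA * T))
        = Real.exp (-r * T) - Real.exp (-RA * T) - pstar + -(p - pstar) := by ring
    have e2 : Real.log lam + -(Real.exp (-r * T) - p - Real.exp (-RB * T))
        = Real.exp (-r * T) - Real.exp (-RA * T) - pstar + (p - pstar) := by
      rw [hpstar]; ring
    rw [e1, e2]; ring
  refine ⟨⟨convex_univ, ?_⟩, ?_⟩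
  · intro x _ y _ hxy a b ha hb hab
    have h1 := strictConvexOn_exp.2 (Set.mem_univ (x - pstar)) (Set.mem_univ (y - pstar))
      (fun h => hxy (by linarith)) ha hb hab
    have h2 := strictConvexOn_exp.2 (Set.mem_univ (-(x - pstar))) (Set.mem_univ (-(y - pstar)))
      (fun h => hxy (by linarith)) ha hb hab
    simp only [smul_eq_mul] at h1 h2 ⊢
    have e1 : a * (x - pstar) + b * (y - pstar) = a * x + b * y - pstar := by
      linear_combination (-pstar) * hab
    have e2 : a * -(x - pstar) + b * -(y - pstar) = -(a * x + b * y - pstar) := by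
      linear_combination pstar * hab
    rw [e1] at h1
    rw [e2] at h2
    rw [hFC, hFC, hFC]
    have h3 := mul_lt_mul_of_pos_left (add_lt_add h1 h2) hC
    linarith
  · intro p hp
    have hx : p - pstar ≠ 0 := sub_ne_zero.2 hp
    have h1 := Real.add_one_lt_exp hx
    have h2 := Real.add_one_lt_exp (neg_ne_zero.2 hx)
    rw [hFC, hFC, sub_self, neg_zero, Real.exp_zero]
    have h3 := mul_lt_mul_of_pos_left (add_lt_add h1 h2) hC
    linarith
end

section
/- Let (Ω, 𝒢, ℙ) be a probability space, let τ : Ω → ℝ be a random variable with τ > 0 almost surely, let (ℱ_t)_{t ≥ 0} be a family of sub-σ-algebras of 𝒢 with ℱ_t ⊆ ℱ_s for t ≤ s, and for each t let 𝒢_t be the σ-algebra generated by ℱ_t together with all events {τ ≤ u} for u ≤ t. For t ≥ 0 let G_t be a version of the conditional expectation 𝔼[1_{{τ > t}} | ℱ_t], and assume G_t > 0 almost surely. Then for every 0 ≤ t ≤ s and every integrable ℱ_s-measurable random variable U, one has 𝔼[1_{{s < τ}} U | 𝒢_t] = 1_{{t < τ}} · G_t^{−1} · 𝔼[G_s U |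 ℱ_t] almost surely. -/
open MeasureTheory

theorem exists_inter_eq {Ω : Type*} (τ : Ω → ℝ) (m : MeasurableSpace Ω) (t : ℝ) (B : Set Ω)
    (hB : MeasurableSet[m ⊔ MeasurableSpace.generateFrom
      {A : Set Ω | ∃ u ≤ t, A = {ω | τ ω ≤ u}}] B) :
    ∃ C, MeasurableSet[m] C ∧ ∀ ω, t < τ ω → (ω ∈ B ↔ ω ∈ C) := by
  let M : MeasurableSpace Ω :=
    { MeasurableSet' := fun B => ∃ C, MeasurableSet[m] C ∧ ∀ ω, t < τ ω → (ω ∈ B ↔ ω ∈ C)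
      measurableSet_empty := ⟨∅, @MeasurableSet.empty _ m, by simp⟩
      measurableSet_compl := by
        rintro B ⟨C, hC, h⟩
        exact ⟨Cᶜ, hC.compl, fun ω hω => not_congr (h ω hω)⟩
      measurableSet_iUnion := by
        intro f hf
        choose C hC h using hf
        refine ⟨⋃ i, C i, MeasurableSet.iUnion hC, fun ω hω => ?_⟩
        simp only [Set.mem_iUnion]
        exact exists_congr fun i => h i ω hω }
  have hle : m ⊔ MeasurableSpace.generateFrom
      {A : Set Ω | ∃ u ≤ t, A = {ω | τ ω ≤ u}} ≤ M := by
    refine sup_le (fun C hC => ⟨C, hC, fun _ _ => Iff.rfl⟩) ?_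
    refine MeasurableSpace.generateFrom_le ?_
    rintro A ⟨u, hu, rfl⟩
    refine ⟨∅, @MeasurableSet.empty _ m, fun ω hω => ?_⟩
    simp only [Set.mem_ofPred_eq, Set.mem_empty_iff_false, iff_false, not_le]
    linarith
  exact hle B hB

/-- Filtration-reduction lemma for the progressive enlargement of a reference filtration
`F` by a default time `τ`: with `𝒢 t = F t ∨ σ({τ ≤ u} : u ≤ t)` and
`G t = ℙ(τ > t | F t) > 0`, for `0 ≤ t ≤ s` and integrable `F s`-measurable `U` one has
`𝔼[1_{s < τ} U | 𝒢 t] = 1_{t < τ} (G t)⁻¹ 𝔼[G s · U | F t]` a.s. -/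
theorem stmt_2 {Ω : Type*} [m0 : MeasurableSpace Ω] (ℙ : Measure Ω) [IsProbabilityMeasure ℙ]
    (τ : Ω → ℝ) (hτ : ∀ᵐ ω ∂ℙ, 0 < τ ω)
    (F : ℝ → MeasurableSpace Ω) (hFle : ∀ t, F t ≤ m0)
    (hFmono : ∀ ⦃s t : ℝ⦄, s ≤ t → F s ≤ F t)
    (𝒢 : ℝ → MeasurableSpace Ω)
    (h𝒢 : ∀ t, 𝒢 t = F t ⊔ MeasurableSpace.generateFrom
      {A : Set Ω | ∃ u ≤ t, A = {ω | τ ω ≤ u}})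
    (h𝒢le : ∀ t, 𝒢 t ≤ m0)
    (G : ℝ → Ω → ℝ)
    (hG : ∀ t : ℝ, G t =ᵐ[ℙ] ℙ[Set.indicator {ω | t < τ ω} (fun _ => (1 : ℝ)) | F t])
    (hGpos : ∀ t : ℝ, ∀ᵐ ω ∂ℙ, 0 < G t ω)
    (t s : ℝ) (h0t : 0 ≤ t) (hts : t ≤ s)
    (U : Ω → ℝ) (hU : Integrable U ℙ) (hUmeas : StronglyMeasurable[F s] U) :
    ℙ[Set.indicator {ω | s < τ ω} U | 𝒢 t] =ᵐ[ℙ]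
      fun ω => Set.indicator {ω' | t < τ ω'}
        (fun ω' => (G t ω')⁻¹ * (ℙ[fun ω'' => G s ω'' * U ω'' | F t]) ω') ω := by
  have hSet : ∀ r, MeasurableSet[𝒢 r] {ω | r < τ ω} := by
    intro r
    have h1 : MeasurableSet[𝒢 r] {ω | τ ω ≤ r} := by
      rw [h𝒢 r]
      exact (le_sup_right : _ ≤ F r ⊔ MeasurableSpace.generateFrom
        {A : Set Ω | ∃ u ≤ r, A = {ω | τ ω ≤ u}}) _
        (MeasurableSpace.measurableSet_generateFrom ⟨r, le_rfl, rfl⟩)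
    have h2 : {ω | r < τ ω} = {ω | τ ω ≤ r}ᶜ := by ext; simp
    rw [h2]; exact h1.compl
  have hSet0 : ∀ r, MeasurableSet {ω | r < τ ω} := fun r => h𝒢le r _ (hSet r)
  have hFG : F t ≤ 𝒢 t := by rw [h𝒢 t]; exact le_sup_left
  set A : Set Ω := {ω | t < τ ω} with hA
  set S : Set Ω := {ω | s < τ ω} with hS
  have hSA : S ⊆ A := fun ω hω => lt_of_le_of_lt hts hω
  set X : Ω → ℝ := S.indicator U with hX
  have hXi : Integrable X ℙ := hU.indicator (hSet0 s)
  have h1i : ∀ r, Integrable (Set.indicator {ω | r < τ ω} (fun _ => (1 : ℝ))) ℙ :=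
    fun r => (integrable_const _).indicator (hSet0 r)
  set V : Ω → ℝ := ℙ[fun ω'' => G s ω'' * U ω'' | F t] with hV
  set H : Ω → ℝ := ℙ[A.indicator (fun _ => (1 : ℝ)) | F t] with hH
  set Z : Ω → ℝ := fun ω => (H ω)⁻¹ * V ω with hZ
  have hVm : StronglyMeasurable[F t] V := stronglyMeasurable_condExp
  have hHm : StronglyMeasurable[F t] H := stronglyMeasurable_condExp
  have hZm : StronglyMeasurable[F t] Z := by
    have := hHm.measurable.inv.mul hVm.measurable
    exact this.stronglyMeasurable
  -- tower property
  have hXV : ℙ[X | F t] =ᵐ[ℙ] V := by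
    have hXeq : X = S.indicator (fun _ => (1 : ℝ)) * U := by
      ext ω; by_cases h : ω ∈ S <;> simp [hX, h]
    have e1 : ℙ[X | F s] =ᵐ[ℙ] fun ω => G s ω * U ω := by
      have := condExp_mul_of_stronglyMeasurable_right (μ := ℙ) hUmeas (hXeq ▸ hXi) (h1i s)
      rw [← hXeq] at this
      filter_upwards [this, hG s] with ω h1 h2
      rw [h1, h2]; rfl
    exact (condExp_condExp_of_le (hFmono hts) (hFle s)).symm.trans (condExp_congr_ae e1)
  let D : ℕ → Set Ω := fun n => {ω | |Z ω| ≤ n}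
  have hD : ∀ n, MeasurableSet[F t] (D n) := fun n =>
    (measurable_norm.comp hZm.measurable) (measurableSet_Iic (a := (n : ℝ)))
  have key : ∀ n, A.indicator ((D n).indicator Z) =ᵐ[ℙ] ℙ[(D n).indicator X | 𝒢 t] := by
    intro n
    have hYm : StronglyMeasurable[F t] ((D n).indicator Z) := hZm.indicator (hD n)
    have hYb : ∀ ω, ‖(D n).indicator Z ω‖ ≤ n := by
      intro ω
      by_cases h : ω ∈ D n
      · rw [Set.indicator_of_mem h]; exact h
      · simp [h]
    have hYi : Integrable ((D n).indicator Z) ℙ :=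
      Integrable.of_bound (hYm.mono (hFle t)).aestronglyMeasurable n (ae_of_all _ hYb)
    have hgi : Integrable (A.indicator ((D n).indicator Z)) ℙ := hYi.indicator (hSet0 t)
    have hgc : ℙ[A.indicator ((D n).indicator Z) | F t] =ᵐ[ℙ] (D n).indicator V := by
      have e : A.indicator ((D n).indicator Z)
          = A.indicator (fun _ => (1 : ℝ)) * ((D n).indicator Z) := by
        ext ω; by_cases h : ω ∈ A <;> simp [h]
      have := condExp_mul_of_stronglyMeasurable_right (μ := ℙ) hYm (e ▸ hgi) (h1i t)
      rw [← e] at this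
      filter_upwards [this, hG t, hGpos t] with ω h1 h2 h3
      rw [h1]
      have h4 : 0 < H ω := by rw [hH, ← h2]; exact h3
      change H ω * _ = _
      by_cases h : ω ∈ D n
      · simp only [h, Set.indicator_of_mem, hZ]
        field_simp
      · simp [h]
    have hDXi : Integrable ((D n).indicator X) ℙ := hXi.indicator (hFle t _ (hD n))
    have hfc : ℙ[(D n).indicator X | F t] =ᵐ[ℙ] (D n).indicator V := by
      refine (condExp_indicator hXi (hD n)).trans ?_
      filter_upwards [hXV] with ω h
      simp only [Set.indicator, h]
    refine ae_eq_condExp_of_forall_setIntegral_eq (h𝒢le t) hDXi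
      (fun _ _ _ => hgi.integrableOn) ?_
      (((hYm.mono hFG).indicator (hSet t)).aestronglyMeasurable)
    intro B hB _
    rw [h𝒢 t] at hB
    obtain ⟨C, hC, hBC⟩ := exists_inter_eq τ (F t) t B hB
    have hB0 : MeasurableSet B := h𝒢le t _ (by rw [h𝒢 t]; exact hB)
    have hC0 := hFle t _ hC
    have tr : ∀ f : Ω → ℝ, (∀ ω, ω ∉ A → f ω = 0) → ∫ ω in B, f ω ∂ℙ = ∫ ω in C, f ω ∂ℙ := by
      intro f hf
      rw [← integral_indicator hB0, ← integral_indicator hC0]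
      congr 1
      ext ω
      by_cases h : ω ∈ A
      · have := hBC ω h
        by_cases hc : ω ∈ C
        · rw [Set.indicator_of_mem hc, Set.indicator_of_mem (this.2 hc)]
        · rw [Set.indicator_of_notMem hc, Set.indicator_of_notMem (fun hb => hc (this.1 hb))]
      · simp [Set.indicator, hf ω h]
    rw [tr _ (fun ω h => by simp [h]), tr _ (fun ω h => by
        have : ω ∉ S := fun h' => h (hSA h')
        simp [Set.indicator, hX, this]),
      ← setIntegral_condExp (hFle t) hgi hC, ← setIntegral_condExp (hFle t) hDXi hC]
    exact integral_congr_ae (ae_restrict_of_ae (hgc.trans hfc.symm))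
  have key2 : ∀ᵐ ω ∂ℙ, ∀ n, A.indicator ((D n).indicator Z) ω
      = (D n).indicator (ℙ[X | 𝒢 t]) ω :=
    ae_all_iff.2 fun n => (key n).trans (condExp_indicator hXi (hFG _ (hD n)))
  filter_upwards [key2, hG t] with ω h1 h2
  obtain ⟨n, hn⟩ := exists_nat_ge |Z ω|
  have hn' : ω ∈ D n := hn
  have h3 := h1 n
  rw [Set.indicator_of_mem hn'] at h3
  rw [← h3]
  by_cases h : ω ∈ A
  · simp only [h, hn', Set.indicator_of_mem, hZ, h2]
    rfl
  · simp [h]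
end

section
/- Fix real parameters γ^A, γ^B, h^A, h^B, L^A, L^B, K, λ, G > 0 and v^A, v^B, v_0^B, δ ∈ ℝ. Let U_A(y) = −exp(−γ^A y) and U_B(y) = −exp(−γ^B y), and set X = v^A − (γ^B/γ^A)(v^B − v_0^B). Then −[G · U_B(v^B − v_0^B)]^{−1} · [1_{{δ ≥ 0}} g⁺(v^A, v^B, δ) + 1_{{δ < 0}} g⁻(v^A, v^B, δ)] = U_A(X)·ψ^A(δ) + λ·U_B(v_0^B)·ψ^B(δ). -/
/-- Reduction of the risk-sharing integrand to a function of the single state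
`X = v^A - (γ^B/γ^A)(v^B - v^B_0)`:
`-(G·U_B(v^B - v^B_0))⁻¹ [1_{δ≥0} g⁺ + 1_{δ<0} g⁻] = U_A(X) ψ^A(δ) + λ U_B(v^B_0) ψ^B(δ)`. -/
theorem stmt_3 (γA γB hA hB LA LB K lam G : ℝ)
    (hγA : 0 < γA) (hγB : 0 < γB) (hhA : 0 < hA) (hhB : 0 < hB)
    (hLA : 0 < LA) (hLB : 0 < LB) (hK : 0 < K) (hlam : 0 < lam) (hG : 0 < G)
    (vA vB vB0 δ : ℝ)
    (UA UB : ℝ → ℝ)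
    (hUA : ∀ y, UA y = -Real.exp (-γA * y))
    (hUB : ∀ y, UB y = -Real.exp (-γB * y))
    (X : ℝ) (hX : X = vA - (γB / γA) * (vB - vB0))
    (gplus gminus ψA ψB : ℝ)
    (hgplus : gplus = G * (hA * (UA (vA + LA * δ) + lam * UB (vB - LA * K * δ))
      + hB * (UA vA + lam * UB vB)))
    (hgminus : gminus = G * (hB * (UA (vA + LB * δ) + lam * UB (vB - LB * K * δ))
      + hA * (UA vA + lam * UB vB)))
    (hψA : ψA = -hA * UA (LA * max δ 0) - hB * UA (-(LB * max (-δ) 0)))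
    (hψB : ψB = -hA * UB (-(LA * K * max δ 0)) - hB * UB (LB * K * max (-δ) 0)) :
    -(G * UB (vB - vB0))⁻¹ * (if 0 ≤ δ then gplus else gminus)
      = UA X * ψA + lam * UB vB0 * ψB := by
  have hne : UB (vB - vB0) ≠ 0 := by
    rw [hUB]; exact neg_ne_zero.mpr (Real.exp_ne_zero _)
  have keyA : ∀ y, UA (vA + y) = UB (vB - vB0) * UA X * UA y := by
    intro y
    have h : -γA * (vA + y) = -γB * (vB - vB0) + -γA * X + -γA * y := by
      rw [hX]; field_simp; ring
    rw [hUA, hUB, hUA, hUA, h, Real.exp_add, Real.exp_add]; ring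
  have keyB : ∀ y, UB (vB + y) = UB (vB - vB0) * UB vB0 * UB y := by
    intro y
    have h : -γB * (vB + y) = -γB * (vB - vB0) + -γB * vB0 + -γB * y := by ring
    rw [hUB, hUB, hUB, hUB, h, Real.exp_add, Real.exp_add]; ring
  have zA : UA 0 = -1 := by simp [hUA]
  have zB : UB 0 = -1 := by simp [hUB]
  have kA0 : UA vA = -(UB (vB - vB0) * UA X) := by
    have := keyA 0
    rw [add_zero, zA] at this; linarith
  have kB0 : UB vB = -(UB (vB - vB0) * UB vB0) := by
    have := keyB 0
    rw [add_zero, zB] at this; linarith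
  have hG' := hG.ne'
  split_ifs with hd
  · rw [max_eq_left hd, max_eq_right (by linarith)] at hψA hψB
    simp only [mul_zero, neg_zero, zA, zB] at hψA hψB
    rw [hgplus, hψA, hψB, sub_eq_add_neg vB (LA * K * δ), keyA, keyB, kA0, kB0]
    generalize UB (vB - vB0) = E at *
    field_simp
    ring
  · push Not at hd
    rw [max_eq_right hd.le, max_eq_left (by linarith)] at hψA hψB
    simp only [mul_zero, neg_zero, zA, zB, mul_neg, neg_neg] at hψA hψB
    rw [hgminus, hψA, hψB, sub_eq_add_neg vB (LB * K * δ), keyA, keyB, kA0, kB0]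
    generalize UB (vB - vB0) = E at *
    field_simp
    ring
end

section
/- Fix real parameters γ^A, γ^B, h^A, h^B, L^A, L^B, K, λ > 0 and x, p, ν^B ∈ ℝ. Then for every δ ∈ ℝ, the derivative of f⁺ at δ vanishes if and only if δ = I⁺, and the derivative of f⁻ at δ vanishes if and only if δ = I⁻, where I⁺ = [γ^B ν^B − γ^B p − γ^A x − ln(λ K γ^B/γ^A)] / (L^A (γ^B K + γ^A)) and I⁻ = [γ^B ν^B − γ^B p − γ^A x − ln(λ K γ^B/γ^A)] / (L^B (γ^B K + γ^A)). Consequently I⁺ is the unique global maximizer of f⁺ on ℝ and I⁻ is the unique global maximizer of f⁻ on ℝ. -/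
theorem aux_stmt_5 (γA γB h L K lam : ℝ)
    (hγA : 0 < γA) (hγB : 0 < γB) (hh : 0 < h) (hL : 0 < L) (hK : 0 < K) (hlam : 0 < lam)
    (x p νB C : ℝ) (f : ℝ → ℝ)
    (hf : ∀ δ, f δ = h * (-Real.exp (-γA * (x + L * δ))
      + lam * -Real.exp (-γB * (νB - p - L * K * δ))) + C)
    (I : ℝ)
    (hI : I = (γB * νB - γB * p - γA * x - Real.log (lam * K * γB / γA))
      / (L * (γB * K + γA))) :
    (∀ δ : ℝ, deriv f δ = 0 ↔ δ = I) ∧ (∀ δ : ℝ, δ ≠ I → f δ < f I) := by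
  have hden : 0 < L * (γB * K + γA) := by positivity
  rw [eq_div_iff hden.ne'] at hI
  obtain ⟨E, hE⟩ : ∃ E, E = Real.exp (-γA * (x + L * I)) := ⟨_, rfl⟩
  obtain ⟨F, hF⟩ : ∃ F, F = Real.exp (-γB * (νB - p - L * K * I)) := ⟨_, rfl⟩
  have hE0 : 0 < E := hE ▸ Real.exp_pos _
  have hF0 : 0 < F := hF ▸ Real.exp_pos _
  have hfoc : γA * E = lam * K * γB * F := by
    have h1 : E = (lam * K * γB / γA) * F := by
      rw [hE, hF]
      nth_rewrite 1 [← Real.exp_log (show 0 < lam * K * γB / γA by positivity)]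
      rw [← Real.exp_add]
      congr 1
      linarith
    rw [h1]
    field_simp
  have hf2 : f = fun δ => h * (-(E * Real.exp (-(γA * L) * (δ - I)))
      + lam * -(F * Real.exp (γB * L * K * (δ - I)))) + C := by
    funext δ
    rw [hf, hE, hF, ← Real.exp_add, ← Real.exp_add]
    ring_nf
  have hd : ∀ δ, deriv f δ = h * L * γA * E *
      (Real.exp (-(γA * L) * (δ - I)) - Real.exp (γB * L * K * (δ - I))) := by
    intro δ
    have e : ∀ c : ℝ, HasDerivAt (fun δ : ℝ => Real.exp (c * (δ - I)))
        (Real.exp (c * (δ - I)) * (c * 1)) δ := fun c =>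
      (((hasDerivAt_id δ).sub_const I).const_mul c).exp
    have := ((((e (-(γA * L))).const_mul E).neg.add
      ((((e (γB * L * K)).const_mul F).neg).const_mul lam)).const_mul h).add_const C
    rw [hf2]
    refine (HasDerivAt.deriv this).trans ?_
    linear_combination (h * L * Real.exp (γB * L * K * (δ - I))) * hfoc
  refine ⟨fun δ => ?_, fun δ hδ => ?_⟩
  · rw [hd, mul_eq_zero, or_iff_right (by positivity), sub_eq_zero, Real.exp_eq_exp]
    constructor
    · intro h1
      have : L * (γB * K + γA) * (δ - I) = 0 := by linarith
      rcases mul_eq_zero.1 this with h2 | h2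
      · exact absurd h2 hden.ne'
      · linarith
    · rintro rfl
      ring
  · have hne : δ - I ≠ 0 := sub_ne_zero.2 hδ
    have h1 := Real.add_one_lt_exp (x := -(γA * L) * (δ - I))
      (mul_ne_zero (neg_ne_zero.2 (by positivity)) hne)
    have h2 := Real.add_one_lt_exp (x := γB * L * K * (δ - I))
      (mul_ne_zero (by positivity) hne)
    rw [hf2]
    simp only [sub_self, mul_zero, Real.exp_zero, mul_one]
    have h3 := mul_lt_mul_of_pos_left h1 hE0
    have h4 := mul_lt_mul_of_pos_left h2 (mul_pos hlam hF0)
    have h5 : L * (δ - I) * (γA * E) = L * (δ - I) * (lam * K * γB * F) := by rw [hfoc]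
    have := mul_lt_mul_of_pos_left (show
      (-(E * Real.exp (-(γA * L) * (δ - I))) + lam * -(F * Real.exp (γB * L * K * (δ - I))))
        < -E + lam * -F by linarith) hh
    linarith

/-- The derivative of `f⁺` (resp. `f⁻`) vanishes exactly at `I⁺` (resp. `I⁻`),
which is therefore the unique global maximizer of `f⁺` (resp. `f⁻`) on ℝ. -/
theorem stmt_5 (γA γB hA hB LA LB K lam : ℝ)
    (hγA : 0 < γA) (hγB : 0 < γB) (hhA : 0 < hA) (hhB : 0 < hB)
    (hLA : 0 < LA) (hLB : 0 < LB) (hK : 0 < K) (hlam : 0 < lam)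
    (x p νB : ℝ)
    (UA UB : ℝ → ℝ)
    (hUA : ∀ y, UA y = -Real.exp (-γA * y))
    (hUB : ∀ y, UB y = -Real.exp (-γB * y))
    (fplus fminus : ℝ → ℝ)
    (hfplus : ∀ δ, fplus δ = hA * (UA (x + LA * δ) + lam * UB (νB - p - LA * K * δ))
      + hB * (UA x + lam * UB (νB - p)))
    (hfminus : ∀ δ, fminus δ = hB * (UA (x + LB * δ) + lam * UB (νB - p - LB * K * δ))
      + hA * (UA x + lam * UB (νB - p)))
    (Iplus Iminus : ℝ)
    (hIplus : Iplus = (γB * νB - γB * p - γA * x - Real.log (lam * K * γB / γA))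
      / (LA * (γB * K + γA)))
    (hIminus : Iminus = (γB * νB - γB * p - γA * x - Real.log (lam * K * γB / γA))
      / (LB * (γB * K + γA))) :
    (∀ δ : ℝ, deriv fplus δ = 0 ↔ δ = Iplus) ∧
    (∀ δ : ℝ, deriv fminus δ = 0 ↔ δ = Iminus) ∧
    (∀ δ : ℝ, δ ≠ Iplus → fplus δ < fplus Iplus) ∧
    (∀ δ : ℝ, δ ≠ Iminus → fminus δ < fminus Iminus) := by
  have hp := aux_stmt_5 γA γB hA LA K lam hγA hγB hhA hLA hK hlam x p νB
    (hB * (UA x + lam * UB (νB - p))) fplus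
    (fun δ => by rw [hfplus, hUA (x + LA * δ), hUB (νB - p - LA * K * δ)]) Iplus hIplus
  have hm := aux_stmt_5 γA γB hB LB K lam hγA hγB hhB hLB hK hlam x p νB
    (hA * (UA x + lam * UB (νB - p))) fminus
    (fun δ => by rw [hfminus, hUA (x + LB * δ), hUB (νB - p - LB * K * δ)]) Iminus hIminus
  exact ⟨hp.1, hm.1, hp.2, hm.2⟩
end

section
/- Fix real parameters γ^A, γ^B, h^A, h^B, L^A, L^B, K, λ > 0 and x, p, ν^B ∈ ℝ, and suppose γ^A x + γ^B p ≤ γ^B ν^B − ln(λ K γ^B/γ^A). Then I⁺ ≥ 0 and I⁻ ≥ 0, the supremum of f⁻ over (−∞, 0] equals f⁻(0) = f⁺(0), the supremum of f⁺ over [0, ∞) equals f⁺(I⁺), and f⁻(0) ≤ f⁺(I⁺); hence the function f(δ) = 1_{{δ ≥ 0}} f⁺(δ) + 1_{{δ < 0}} f⁻(δ) attains its supremum over ℝ at δ = I⁺. -/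
theorem tangent_exp (u v : ℝ) : Real.exp v * (1 + (u - v)) ≤ Real.exp u := by
  have h := Real.add_one_le_exp (u - v)
  have h2 : Real.exp u = Real.exp v * Real.exp (u - v) := by
    rw [← Real.exp_add]; congr 1; ring
  rw [h2]
  exact mul_le_mul_of_nonneg_left (by linarith) (Real.exp_pos v).le

theorem key_ineq (a b K lam x c : ℝ) (ha : 0 < a) (hb : 0 < b) (hK : 0 < K) (hlam : 0 < lam)
    (s t : ℝ)
    (h : 0 ≤ (t - s) * (Real.exp (Real.log (lam * K * b / a) + -b * (c - K * s))
      - Real.exp (-a * (x + s)))) :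
    -Real.exp (-a * (x + t)) + lam * -Real.exp (-b * (c - K * t))
      ≤ -Real.exp (-a * (x + s)) + lam * -Real.exp (-b * (c - K * s)) := by
  rw [Real.exp_add, Real.exp_log (by positivity)] at h
  have h1 := tangent_exp (-a * (x + t)) (-a * (x + s))
  have h2 := mul_le_mul_of_nonneg_left
    (tangent_exp (-b * (c - K * t)) (-b * (c - K * s))) hlam.le
  have h3 := mul_nonneg ha.le h
  have h4 : a * ((t - s) * (lam * K * b / a * Real.exp (-b * (c - K * s))
      - Real.exp (-a * (x + s)))) = (t - s) * (lam * K * b * Real.exp (-b * (c - K * s))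
      - a * Real.exp (-a * (x + s))) := by
    field_simp
  rw [h4] at h3
  linarith

/-- Case (I) of the optimal-collateral lemma: if
`γ^A x + γ^B p ≤ γ^B ν^B - ln(λ K γ^B/γ^A)` then `I⁺, I⁻ ≥ 0`, the supremum of `f⁻`
on `(-∞,0]` is `f⁻(0) = f⁺(0)`, the supremum of `f⁺` on `[0,∞)` is `f⁺(I⁺)`,
`f⁻(0) ≤ f⁺(I⁺)`, and `f = 1_{δ≥0} f⁺ + 1_{δ<0} f⁻` attains its supremum at `I⁺`. -/
theorem stmt_7 (γA γB hA hB LA LB K lam : ℝ)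
    (hγA : 0 < γA) (hγB : 0 < γB) (hhA : 0 < hA) (hhB : 0 < hB)
    (hLA : 0 < LA) (hLB : 0 < LB) (hK : 0 < K) (hlam : 0 < lam)
    (x p νB : ℝ)
    (UA UB : ℝ → ℝ)
    (hUA : ∀ y, UA y = -Real.exp (-γA * y))
    (hUB : ∀ y, UB y = -Real.exp (-γB * y))
    (fplus fminus f : ℝ → ℝ)
    (hfplus : ∀ δ, fplus δ = hA * (UA (x + LA * δ) + lam * UB (νB - p - LA * K * δ))
      + hB * (UA x + lam * UB (νB - p)))
    (hfminus : ∀ δ, fminus δ = hB * (UA (x + LB * δ) + lam * UB (νB - p - LB * K * δ))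
      + hA * (UA x + lam * UB (νB - p)))
    (hf : ∀ δ, f δ = if 0 ≤ δ then fplus δ else fminus δ)
    (Iplus Iminus : ℝ)
    (hIplus : Iplus = (γB * νB - γB * p - γA * x - Real.log (lam * K * γB / γA))
      / (LA * (γB * K + γA)))
    (hIminus : Iminus = (γB * νB - γB * p - γA * x - Real.log (lam * K * γB / γA))
      / (LB * (γB * K + γA)))
    (hcase : γA * x + γB * p ≤ γB * νB - Real.log (lam * K * γB / γA)) :
    0 ≤ Iplus ∧ 0 ≤ Iminus ∧
    (∀ δ ≤ (0 : ℝ), fminus δ ≤ fminus 0) ∧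
    fminus 0 = fplus 0 ∧
    (∀ δ : ℝ, 0 ≤ δ → fplus δ ≤ fplus Iplus) ∧
    fminus 0 ≤ fplus Iplus ∧
    (∀ δ : ℝ, f δ ≤ f Iplus) := by
  have hD : 0 < γB * K + γA := by positivity
  have hIp : 0 ≤ Iplus := by
    rw [hIplus]; exact div_nonneg (by linarith) (by positivity)
  have hIm : 0 ≤ Iminus := by
    rw [hIminus]; exact div_nonneg (by linarith) (by positivity)
  have h3 : ∀ δ ≤ (0 : ℝ), fminus δ ≤ fminus 0 := by
    intro δ hδ
    have hk := key_ineq γA γB K lam x (νB - p) hγA hγB hK hlam 0 (LB * δ) (by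
      apply mul_nonneg_of_nonpos_of_nonpos
      · nlinarith
      · rw [sub_nonpos, Real.exp_le_exp]; linarith)
    have e1 : νB - p - LB * K * δ = νB - p - K * (LB * δ) := by ring
    have e2 : νB - p - LB * K * 0 = νB - p - K * 0 := by ring
    have e3 : x + LB * 0 = x + 0 := by ring
    rw [hfminus, hfminus, e1, e2, e3]
    simp only [hUA, hUB]
    have := mul_le_mul_of_nonneg_left hk hhB.le
    linarith
  have h4 : fminus 0 = fplus 0 := by
    rw [hfminus, hfplus]; simp only [mul_zero, add_zero, sub_zero]; ring
  have h5 : ∀ δ : ℝ, fplus δ ≤ fplus Iplus := by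
    intro δ
    have hI : LA * Iplus * (γB * K + γA)
        = γB * νB - γB * p - γA * x - Real.log (lam * K * γB / γA) := by
      rw [hIplus]; field_simp
    have hk := key_ineq γA γB K lam x (νB - p) hγA hγB hK hlam (LA * Iplus) (LA * δ) (by
      have : Real.log (lam * K * γB / γA) + -γB * (νB - p - K * (LA * Iplus))
          = -γA * (x + LA * Iplus) := by linarith
      rw [this, sub_self, mul_zero])
    have e1 : ∀ d, νB - p - LA * K * d = νB - p - K * (LA * d) := by intro d; ring
    rw [hfplus, hfplus, e1, e1]
    simp only [hUA, hUB]
    have := mul_le_mul_of_nonneg_left hk hhA.le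
    linarith
  have h6 : fminus 0 ≤ fplus Iplus := h4 ▸ h5 0
  refine ⟨hIp, hIm, h3, h4, fun δ _ => h5 δ, h6, fun δ => ?_⟩
  rw [hf, hf, if_pos hIp]
  split_ifs with h
  · exact h5 δ
  · exact (h3 δ (not_le.mp h).le).trans h6
end

section
/- Fix real parameters γ^A, γ^B, h^A, h^B, L^A, L^B, K, λ > 0 and x, p, ν^B ∈ ℝ, and suppose γ^A x + γ^B p > γ^B ν^B − ln(λ K γ^B/γ^A). Then I⁺ < 0 and I⁻ < 0, the supremum of f⁺ over [0, ∞) equals f⁺(0) = f⁻(0), the supremum of f⁻ over (−∞, 0] equals f⁻(I⁻), and f⁺(0) ≤ f⁻(I⁻); hence the function f(δ) = 1_{{δ ≥ 0}} f⁺(δ) + 1_{{δ < 0}} f⁻(δ) attains its supremum over ℝ at δ = I⁻. -/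
lemma grad_aux (a b : ℝ) : Real.exp a + Real.exp a * (b - a) ≤ Real.exp b := by
  have h1 := Real.add_one_le_exp (b - a)
  have h2 : Real.exp b = Real.exp a * Real.exp (b - a) := by
    rw [← Real.exp_add]; congr 1; ring
  rw [h2]
  nlinarith [Real.exp_pos a]

lemma g_aux (γA γB K lam x q s t : ℝ) (hlam : 0 < lam) :
    Real.exp (-γA * (x + s)) + lam * Real.exp (-γB * (q - K * s))
      + (t - s) * (lam * K * γB * Real.exp (-γB * (q - K * s)) - γA * Real.exp (-γA * (x + s)))
    ≤ Real.exp (-γA * (x + t)) + lam * Real.exp (-γB * (q - K * t)) := by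
  have h1 := grad_aux (-γA * (x + s)) (-γA * (x + t))
  have h2 := mul_le_mul_of_nonneg_left
    (grad_aux (-γB * (q - K * s)) (-γB * (q - K * t))) hlam.le
  linarith

/-- Case (II) of the optimal-collateral lemma: if
`γ^A x + γ^B p > γ^B ν^B - ln(λ K γ^B/γ^A)` then `I⁺, I⁻ < 0`, the supremum of `f⁺`
on `[0,∞)` is `f⁺(0) = f⁻(0)`, the supremum of `f⁻` on `(-∞,0]` is `f⁻(I⁻)`,
`f⁺(0) ≤ f⁻(I⁻)`, and `f = 1_{δ≥0} f⁺ + 1_{δ<0} f⁻` attains its supremum at `I⁻`. -/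
theorem stmt_8 (γA γB hA hB LA LB K lam : ℝ)
    (hγA : 0 < γA) (hγB : 0 < γB) (hhA : 0 < hA) (hhB : 0 < hB)
    (hLA : 0 < LA) (hLB : 0 < LB) (hK : 0 < K) (hlam : 0 < lam)
    (x p νB : ℝ)
    (UA UB : ℝ → ℝ)
    (hUA : ∀ y, UA y = -Real.exp (-γA * y))
    (hUB : ∀ y, UB y = -Real.exp (-γB * y))
    (fplus fminus f : ℝ → ℝ)
    (hfplus : ∀ δ, fplus δ = hA * (UA (x + LA * δ) + lam * UB (νB - p - LA * K * δ))
      + hB * (UA x + lam * UB (νB - p)))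
    (hfminus : ∀ δ, fminus δ = hB * (UA (x + LB * δ) + lam * UB (νB - p - LB * K * δ))
      + hA * (UA x + lam * UB (νB - p)))
    (hf : ∀ δ, f δ = if 0 ≤ δ then fplus δ else fminus δ)
    (Iplus Iminus : ℝ)
    (hIplus : Iplus = (γB * νB - γB * p - γA * x - Real.log (lam * K * γB / γA))
      / (LA * (γB * K + γA)))
    (hIminus : Iminus = (γB * νB - γB * p - γA * x - Real.log (lam * K * γB / γA))
      / (LB * (γB * K + γA)))
    (hcase : γB * νB - Real.log (lam * K * γB / γA) < γA * x + γB * p) :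
    Iplus < 0 ∧ Iminus < 0 ∧
    (∀ δ : ℝ, 0 ≤ δ → fplus δ ≤ fplus 0) ∧
    fplus 0 = fminus 0 ∧
    (∀ δ ≤ (0 : ℝ), fminus δ ≤ fminus Iminus) ∧
    fplus 0 ≤ fminus Iminus ∧
    (∀ δ : ℝ, f δ ≤ f Iminus) := by
  have hc : 0 < lam * K * γB / γA := by positivity
  have hD : 0 < γB * K + γA := by positivity
  have key : ∀ y, lam * K * γB * Real.exp y
      = γA * Real.exp (Real.log (lam * K * γB / γA) + y) := by
    intro y
    rw [Real.exp_add, Real.exp_log hc]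
    field_simp
  have hIp : Iplus < 0 := by
    rw [hIplus]; exact div_neg_of_neg_of_pos (by linarith) (by positivity)
  have hIm : Iminus < 0 := by
    rw [hIminus]; exact div_neg_of_neg_of_pos (by linarith) (by positivity)
  have hP : ∀ δ : ℝ, 0 ≤ δ → fplus δ ≤ fplus 0 := by
    intro δ hδ
    have h := g_aux γA γB K lam x (νB - p) 0 (LA * δ) hlam
    have hs : 0 ≤ lam * K * γB * Real.exp (-γB * (νB - p - K * 0))
        - γA * Real.exp (-γA * (x + 0)) := by
      rw [key, ← mul_sub]
      apply mul_nonneg hγA.le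
      rw [sub_nonneg, Real.exp_le_exp]
      linarith
    have h3 : 0 ≤ (LA * δ - 0) * (lam * K * γB * Real.exp (-γB * (νB - p - K * 0))
        - γA * Real.exp (-γA * (x + 0))) := mul_nonneg (by rw [sub_zero]; positivity) hs
    have h4 := mul_le_mul_of_nonneg_left (le_trans (le_add_of_nonneg_right h3) h) hhA.le
    rw [hfplus, hfplus]
    simp only [hUA, hUB, mul_zero, add_zero, sub_zero] at h4 ⊢
    rw [show LA * K * δ = K * (LA * δ) by ring]
    linarith
  have hM : ∀ δ : ℝ, fminus δ ≤ fminus Iminus := by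
    intro δ
    have h := g_aux γA γB K lam x (νB - p) (LB * Iminus) (LB * δ) hlam
    have hI : LB * Iminus * (γB * K + γA)
        = γB * νB - γB * p - γA * x - Real.log (lam * K * γB / γA) := by
      rw [hIminus]; field_simp
    have hs : lam * K * γB * Real.exp (-γB * (νB - p - K * (LB * Iminus)))
        - γA * Real.exp (-γA * (x + LB * Iminus)) = 0 := by
      rw [key, sub_eq_zero]
      congr 2
      linarith
    rw [hs, mul_zero, add_zero] at h
    have h4 := mul_le_mul_of_nonneg_left h hhB.le
    rw [hfminus, hfminus]
    simp only [hUA, hUB] at h4 ⊢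
    rw [show LB * K * δ = K * (LB * δ) by ring,
      show LB * K * Iminus = K * (LB * Iminus) by ring]
    linarith
  have h0 : fplus 0 = fminus 0 := by
    rw [hfplus, hfminus]
    simp only [mul_zero, add_zero, sub_zero]
    ring
  refine ⟨hIp, hIm, hP, h0, fun δ _ => hM δ, h0 ▸ hM 0, ?_⟩
  intro δ
  rw [hf, hf Iminus, if_neg (not_le.mpr hIm)]
  split_ifs with h
  · exact (hP δ h).trans (h0 ▸ hM 0)
  · exact hM δ
end

section
/- Fix real parameters γ^A, γ^B, h^A, h^B, L^A, L^B, K, λ > 0 and x, p, ν^B ∈ ℝ. Then the function f(δ) = 1_{{δ ≥ 0}} f⁺(δ) + 1_{{δ < 0}} f⁻(δ) attains its supremum over ℝ at the point δ* = max(0, I⁺) + min(0, I⁻); that is, f(δ*) ≥ f(δ) for every δ ∈ ℝ. -/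
theorem aux_tangent (γA γB K lam x q Z : ℝ)
    (hγA : 0 < γA) (hγB : 0 < γB) (hK : 0 < K) (hlam : 0 < lam)
    (hZ : (γB * K + γA) * Z = γB * q - γA * x - Real.log (lam * K * γB / γA))
    (w z : ℝ) (h : 0 ≤ (w - z) * (Z - w)) :
    -Real.exp (-γA * (x + z)) + lam * -Real.exp (-γB * (q - K * z)) ≤
    -Real.exp (-γA * (x + w)) + lam * -Real.exp (-γB * (q - K * w)) := by
  have tan : ∀ u v : ℝ, Real.exp v * (1 + (u - v)) ≤ Real.exp u := by
    intro u v
    have h1 := Real.add_one_le_exp (u - v)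
    have h2 : Real.exp u = Real.exp v * Real.exp (u - v) := by
      rw [← Real.exp_add]; congr 1; ring
    rw [h2]
    exact mul_le_mul_of_nonneg_left (by linarith) (Real.exp_pos v).le
  have t1 := tan (-γA * (x + z)) (-γA * (x + w))
  have t2 := mul_le_mul_of_nonneg_left (tan (-γB * (q - K * z)) (-γB * (q - K * w))) hlam.le
  set c := Real.log (lam * K * γB / γA) with hc
  have hec : γA * Real.exp c = lam * K * γB := by
    rw [hc, Real.exp_log (by positivity)]; field_simp
  have hE : γA * Real.exp (c + -γB * (q - K * w))
      = lam * K * γB * Real.exp (-γB * (q - K * w)) := by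
    rw [Real.exp_add, ← hec]; ring
  have hdiff : -γA * (x + w) - (c + -γB * (q - K * w)) = (γB * K + γA) * (Z - w) := by
    linear_combination -hZ
  have hs : 0 < γB * K + γA := by positivity
  have key : 0 ≤ (w - z) *
      (Real.exp (-γA * (x + w)) - Real.exp (c + -γB * (q - K * w))) := by
    rcases lt_trichotomy (Z - w) 0 with hn | h0 | hp
    · have hz : w - z ≤ 0 := by
        by_contra hcon
        push Not at hcon
        nlinarith [mul_neg_of_pos_of_neg hcon hn]
      refine mul_nonneg_of_nonpos_of_nonpos hz (sub_nonpos.2 (Real.exp_le_exp.2 ?_))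
      have := mul_neg_of_pos_of_neg hs hn
      linarith
    · rw [h0, mul_zero] at hdiff
      rw [sub_eq_zero.1 hdiff, sub_self, mul_zero]
    · have hz : 0 ≤ w - z := nonneg_of_mul_nonneg_left h hp
      refine mul_nonneg hz (sub_nonneg.2 (Real.exp_le_exp.2 ?_))
      have := mul_pos hs hp
      linarith
  have key2 := mul_nonneg hγA.le key
  have e : γA * ((w - z) *
      (Real.exp (-γA * (x + w)) - Real.exp (c + -γB * (q - K * w))))
      = (w - z) * (γA * Real.exp (-γA * (x + w))
        - lam * K * γB * Real.exp (-γB * (q - K * w))) := by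
    rw [← hE]; ring
  rw [e] at key2
  linarith

/-- The piecewise function `f = 1_{δ≥0} f⁺ + 1_{δ<0} f⁻` attains its supremum over ℝ at
the optimal residual exposure `δ* = max(0, I⁺) + min(0, I⁻)`. -/
theorem stmt_9 (γA γB hA hB LA LB K lam : ℝ)
    (hγA : 0 < γA) (hγB : 0 < γB) (hhA : 0 < hA) (hhB : 0 < hB)
    (hLA : 0 < LA) (hLB : 0 < LB) (hK : 0 < K) (hlam : 0 < lam)
    (x p νB : ℝ)
    (UA UB : ℝ → ℝ)
    (hUA : ∀ y, UA y = -Real.exp (-γA * y))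
    (hUB : ∀ y, UB y = -Real.exp (-γB * y))
    (fplus fminus f : ℝ → ℝ)
    (hfplus : ∀ δ, fplus δ = hA * (UA (x + LA * δ) + lam * UB (νB - p - LA * K * δ))
      + hB * (UA x + lam * UB (νB - p)))
    (hfminus : ∀ δ, fminus δ = hB * (UA (x + LB * δ) + lam * UB (νB - p - LB * K * δ))
      + hA * (UA x + lam * UB (νB - p)))
    (hf : ∀ δ, f δ = if 0 ≤ δ then fplus δ else fminus δ)
    (Iplus Iminus δstar : ℝ)
    (hIplus : Iplus = (γB * νB - γB * p - γA * x - Real.log (lam * K * γB / γA))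
      / (LA * (γB * K + γA)))
    (hIminus : Iminus = (γB * νB - γB * p - γA * x - Real.log (lam * K * γB / γA))
      / (LB * (γB * K + γA)))
    (hδstar : δstar = max 0 Iplus + min 0 Iminus) :
    ∀ δ : ℝ, f δ ≤ f δstar := by
  have hs : 0 < γB * K + γA := by positivity
  obtain ⟨Z, hZ⟩ : ∃ Z, Z = (γB * νB - γB * p - γA * x - Real.log (lam * K * γB / γA))
      / (γB * K + γA) := ⟨_, rfl⟩
  have hZ' : (γB * K + γA) * Z
      = γB * (νB - p) - γA * x - Real.log (lam * K * γB / γA) := by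
    rw [hZ]; field_simp
  have hp : Iplus = Z / LA := by
    rw [hIplus, hZ, div_div]; congr 1; ring
  have hm : Iminus = Z / LB := by
    rw [hIminus, hZ, div_div]; congr 1; ring
  obtain ⟨g, hg⟩ : ∃ g : ℝ → ℝ, ∀ z, g z =
      -Real.exp (-γA * (x + z)) + lam * -Real.exp (-γB * ((νB - p) - K * z)) := ⟨_, fun _ => rfl⟩
  have G : ∀ w z, 0 ≤ (w - z) * (Z - w) → g z ≤ g w := by
    intro w z h
    rw [hg, hg]
    exact aux_tangent γA γB K lam x (νB - p) Z hγA hγB hK hlam hZ' w z h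
  have g0 : UA x + lam * UB (νB - p) = g 0 := by
    rw [hg, hUA, hUB]; simp
  have gp : ∀ δ, fplus δ = hA * g (LA * δ) + hB * g 0 := by
    intro δ
    rw [hfplus, g0, hg (LA * δ), hUA, hUB]
    ring_nf
  have gm : ∀ δ, fminus δ = hB * g (LB * δ) + hA * g 0 := by
    intro δ
    rw [hfminus, g0, hg (LB * δ), hUA, hUB]
    ring_nf
  have GZ : ∀ z, g z ≤ g Z := fun z => G Z z (by simp)
  intro δ
  have mA : ∀ {a b}, a ≤ b → hA * a ≤ hA * b := fun h => mul_le_mul_of_nonneg_left h hhA.le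
  have mB : ∀ {a b}, a ≤ b → hB * a ≤ hB * b := fun h => mul_le_mul_of_nonneg_left h hhB.le
  rcases le_or_gt 0 Z with h | h
  · have h1 : 0 ≤ Z / LA := by positivity
    have h2 : 0 ≤ Z / LB := by positivity
    have hd : δstar = Z / LA := by
      rw [hδstar, hp, hm, max_eq_right h1, min_eq_left h2, add_zero]
    have hv : f δstar = hA * g Z + hB * g 0 := by
      rw [hf, hd, if_pos h1, gp, mul_div_cancel₀ _ hLA.ne']
    rw [hv, hf]
    split_ifs with hδ
    · rw [gp]
      linarith [mA (GZ (LA * δ))]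
    · push Not at hδ
      rw [gm]
      have h3 : LB * δ < 0 := mul_neg_of_pos_of_neg hLB hδ
      have h4 := mB (G 0 (LB * δ) (mul_nonneg (by linarith) (by linarith)))
      linarith [mA (GZ 0)]
  · have h1 : Z / LA < 0 := div_neg_of_neg_of_pos h hLA
    have h2 : Z / LB < 0 := div_neg_of_neg_of_pos h hLB
    have hd : δstar = Z / LB := by
      rw [hδstar, hp, hm, max_eq_left h1.le, min_eq_right h2.le, zero_add]
    have hv : f δstar = hB * g Z + hA * g 0 := by
      rw [hf, hd, if_neg (not_le.2 h2), gm, mul_div_cancel₀ _ hLB.ne']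
    rw [hv, hf]
    split_ifs with hδ
    · rw [gp]
      have h3 : 0 ≤ LA * δ := by positivity
      have h4 := mA (G 0 (LA * δ) (mul_nonneg_of_nonpos_of_nonpos (by linarith) (by linarith)))
      linarith [mB (GZ 0)]
    · rw [gm]
      linarith [mB (GZ (LB * δ))]
end

section
/- Fix real parameters γ^B, h^B, L^B, K, λ, G > 0, s ≥ 0, I ∈ ℝ with G(h^B L^B + s) + sI > 0, and v^A, v^B, α, δ^E, h^Δ, h^A, L^A ∈ ℝ. Then the function δ ↦ g̃⁻(δ) + sIδ is strictly concave on ℝ, and its derivative at δ vanishes if and only if δ = Î⁻ = −(δ^E)⁺ + v^B/(K L^B) + (γ^B K L^B)^{−1} ln[(G(h^B L^B + s) + sI)/(G λ γ^B K h^B L^B)]; hence Î⁻ is its unique global maximizer on ℝ. -/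
theorem aux_13 (f : ℝ → ℝ) (C P c m : ℝ) (hP : 0 < P) (hc : 0 < c)
    (hf : f = fun x => C + P * x - P / c * Real.exp (c * (x - m))) :
    StrictConcaveOn ℝ Set.univ f ∧ (∀ x, deriv f x = 0 ↔ x = m) ∧
    (∀ x, x ≠ m → f x < f m) := by
  have hd : ∀ x, HasDerivAt f (P - P * Real.exp (c * (x - m))) x := by
    intro x
    rw [hf]
    have h1 : HasDerivAt (fun x : ℝ => c * (x - m)) (c * 1) x :=
      ((hasDerivAt_id x).sub_const m).const_mul c
    have h2 := (((hasDerivAt_id x).const_mul P).const_add C).sub (h1.exp.const_mul (P / c))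
    refine HasDerivAt.congr_deriv h2 ?_
    field_simp
  have hder : deriv f = fun x => P - P * Real.exp (c * (x - m)) := funext fun x => (hd x).deriv
  refine ⟨?_, ?_, ?_⟩
  · apply StrictAntiOn.strictConcaveOn_of_deriv convex_univ
    · exact fun x _ => (hd x).continuousAt.continuousWithinAt
    · rw [hder]
      intro x _ y _ hxy
      have : Real.exp (c * (x - m)) < Real.exp (c * (y - m)) := by
        apply Real.exp_lt_exp.2
        exact mul_lt_mul_of_pos_left (by linarith) hc
      have := mul_lt_mul_of_pos_left this hP
      show P - _ < P - _
      linarith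
  · intro x
    rw [hder]
    constructor
    · intro h
      have h1 : P * (Real.exp (c * (x - m)) - 1) = 0 := by
        have h' : P - P * Real.exp (c * (x - m)) = 0 := h
        linarith
      have h2 : Real.exp (c * (x - m)) = 1 := by
        rcases mul_eq_zero.1 h1 with h | h <;> linarith
      rw [Real.exp_eq_one_iff] at h2
      rcases mul_eq_zero.1 h2 with h | h <;> linarith
    · rintro rfl
      simp
  · intro x hx
    have h0 : c * (x - m) ≠ 0 := mul_ne_zero hc.ne' (sub_ne_zero.2 hx)
    have h1 := Real.add_one_lt_exp h0
    have h2 := mul_lt_mul_of_pos_left h1 (div_pos hP hc)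
    have h3 : P / c * (c * (x - m) + 1) = P * (x - m) + P / c := by
      field_simp
    rw [hf]
    simp only [sub_self, mul_zero, Real.exp_zero, mul_one]
    linarith

/-- Risk-neutral agent A case: the map `δ ↦ g̃⁻(δ) + s I δ` is strictly concave, its
derivative vanishes exactly at `Î⁻`, and `Î⁻` is its unique global maximizer. -/
theorem stmt_13 (γB hB LB K lam G : ℝ)
    (hγB : 0 < γB) (hhB : 0 < hB) (hLB : 0 < LB) (hK : 0 < K) (hlam : 0 < lam)
    (hG : 0 < G)
    (s : ℝ) (hs : 0 ≤ s) (I : ℝ) (hpos : 0 < G * (hB * LB + s) + s * I)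
    (vA vB α δE hΔ hA LA : ℝ)
    (UB : ℝ → ℝ) (hUB : ∀ y, UB y = -Real.exp (-γB * y))
    (gm : ℝ → ℝ)
    (hgm : ∀ δ, gm δ = G * (hΔ * vA + (hB * LB + s) * δ + α
      + (hB * LB - hA * LA) * max δE 0
      + lam * hB * UB (vB - LB * K * (δ + max δE 0))
      + lam * hA * UB (vB + LA * K * max δE 0)))
    (Im : ℝ)
    (hIm : Im = -(max δE 0) + vB / (K * LB)
      + (γB * K * LB)⁻¹
        * Real.log ((G * (hB * LB + s) + s * I) / (G * lam * γB * K * hB * LB))) :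
    StrictConcaveOn ℝ Set.univ (fun δ => gm δ + s * I * δ) ∧
    (∀ δ : ℝ, deriv (fun δ' => gm δ' + s * I * δ') δ = 0 ↔ δ = Im) ∧
    (∀ δ : ℝ, δ ≠ Im → gm δ + s * I * δ < gm Im + s * I * Im) := by
  have hc : 0 < γB * K * LB := by positivity
  have hD : 0 < G * lam * γB * K * hB * LB := by positivity
  refine aux_13 (fun δ => gm δ + s * I * δ)
    (G * (hΔ * vA + α + (hB * LB - hA * LA) * max δE 0
      + lam * hA * UB (vB + LA * K * max δE 0)))
    (G * (hB * LB + s) + s * I) (γB * K * LB) Im hpos hc ?_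
  funext δ
  have key : -γB * (vB - LB * K * (δ + max δE 0)) = γB * K * LB * (δ - Im)
      + Real.log ((G * (hB * LB + s) + s * I) / (G * lam * γB * K * hB * LB)) := by
    rw [hIm]
    generalize Real.log _ = l
    field_simp
    ring
  simp only [hgm]
  rw [hUB (vB - LB * K * (δ + max δE 0)), key, Real.exp_add, Real.exp_log (div_pos hpos hD)]
  generalize Real.exp _ = e
  generalize UB _ = u
  generalize max δE 0 = m
  field_simp
  ring
end

section
/- Fix real parameters γ^B, h^A, h^B, L^A, L^B, K, λ, G > 0, s ≥ 0, I ∈ ℝ with G(h^A L^A + s) + sI > 0 and G(h^B L^B + s) + sI > 0, and v^A, v^B, α, δ^E, h^Δ ∈ ℝ. Define G̃(δ) = 1_{{δ + δ^E ≥ 0}} g̃⁺(δ) + 1_{{δ + δ^E < 0}} g̃⁻(δ) + sIδ. Then G̃ is continuous on ℝ (in particular g̃⁺(−δ^E) = g̃⁻(−δ^E)), G̃(δ) → −∞ as δ → ±∞, G̃ attains its supremum over ℝ, and every global maximizer of G̃ belongs to the three-point set {Î⁺, Î⁻, −δ^E}. -/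
theorem aux_top (c a b k d : ℝ) (ha : 0 < a) (hb : 0 < b) (hk : 0 < k) :
    Filter.Tendsto (fun x : ℝ => c + a * x - b * Real.exp (k * x + d)) Filter.atTop
      Filter.atBot := by
  set M := Real.log ((a + 1) / (b * k)) with hM
  have hE : Real.exp M = (a + 1) / (b * k) := Real.exp_log (by positivity)
  have h1 : Filter.Tendsto (fun x : ℝ => (c - (a + 1) / k * (1 + d - M)) + -x)
      Filter.atTop Filter.atBot :=
    Filter.tendsto_atBot_add_const_left _ _ Filter.tendsto_neg_atTop_atBot
  refine Filter.tendsto_atBot_mono (fun x => ?_) h1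
  have h2 : Real.exp (k * x + d) = (a + 1) / (b * k) * Real.exp (k * x + d - M) := by
    rw [← hE, ← Real.exp_add]; congr 1; ring
  have h3 := Real.add_one_le_exp (k * x + d - M)
  have h4 : b * Real.exp (k * x + d) = (a + 1) / k * Real.exp (k * x + d - M) := by
    rw [h2]; field_simp
  have h5 : (a + 1) / k * (k * x + d - M + 1) ≤ (a + 1) / k * Real.exp (k * x + d - M) :=
    mul_le_mul_of_nonneg_left h3 (by positivity)
  have h6 : (a + 1) / k * (k * x + d - M + 1)
      = (a + 1) * x + (a + 1) / k * (1 + d - M) := by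
    field_simp; ring
  rw [h4]; linarith

theorem aux_bot (c a b k d : ℝ) (ha : 0 < a) (hb : 0 < b) :
    Filter.Tendsto (fun x : ℝ => c + a * x - b * Real.exp (k * x + d)) Filter.atBot
      Filter.atBot := by
  have h1 : Filter.Tendsto (fun x : ℝ => c + a * x) Filter.atBot Filter.atBot :=
    Filter.tendsto_atBot_add_const_left _ _ (Filter.tendsto_id.const_mul_atBot ha)
  refine Filter.tendsto_atBot_mono (fun x => ?_) h1
  have : 0 < b * Real.exp (k * x + d) := by positivity
  linarith

theorem aux_crit (c a b k d x : ℝ) (ha : 0 < a) (hb : 0 < b) (hk : 0 < k)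
    (h : IsLocalMax (fun x : ℝ => c + a * x - b * Real.exp (k * x + d)) x) :
    x = (Real.log (a / (b * k)) - d) / k := by
  have hd : HasDerivAt (fun x : ℝ => c + a * x - b * Real.exp (k * x + d))
      (a * 1 - b * (Real.exp (k * x + d) * (k * 1))) x :=
    (((hasDerivAt_id x).const_mul a).const_add c).sub
      (((((hasDerivAt_id x).const_mul k).add_const d).exp).const_mul b)
  have h0 := h.hasDerivAt_eq_zero hd
  have h1 : a / (b * k) = Real.exp (k * x + d) := by
    rw [div_eq_iff (by positivity)]; linarith
  rw [h1, Real.log_exp]; field_simp; ring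

/-- The pointwise objective `G̃(δ) = 1_{δ+δ^E ≥ 0} g̃⁺(δ) + 1_{δ+δ^E < 0} g̃⁻(δ) + s I δ`
is continuous (in particular `g̃⁺(-δ^E) = g̃⁻(-δ^E)`), tends to `-∞` at `±∞`, attains its
supremum over ℝ, and every global maximizer lies in `{Î⁺, Î⁻, -δ^E}`. -/
theorem stmt_16 (γB hA hB LA LB K lam G : ℝ)
    (hγB : 0 < γB) (hhA : 0 < hA) (hhB : 0 < hB) (hLA : 0 < LA) (hLB : 0 < LB)
    (hK : 0 < K) (hlam : 0 < lam) (hG : 0 < G)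
    (s : ℝ) (hs : 0 ≤ s) (I : ℝ)
    (hposA : 0 < G * (hA * LA + s) + s * I) (hposB : 0 < G * (hB * LB + s) + s * I)
    (vA vB α δE hΔ : ℝ)
    (UB : ℝ → ℝ) (hUB : ∀ y, UB y = -Real.exp (-γB * y))
    (gp gm Gt : ℝ → ℝ)
    (hgp : ∀ δ, gp δ = G * (hΔ * vA + (hA * LA + s) * δ + α
      + (hB * LB - hA * LA) * max (-δE) 0
      + lam * hA * UB (vB - LA * K * (δ - max (-δE) 0))
      + lam * hB * UB (vB - LB * K * max (-δE) 0)))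
    (hgm : ∀ δ, gm δ = G * (hΔ * vA + (hB * LB + s) * δ + α
      + (hB * LB - hA * LA) * max δE 0
      + lam * hB * UB (vB - LB * K * (δ + max δE 0))
      + lam * hA * UB (vB + LA * K * max δE 0)))
    (hGt : ∀ δ, Gt δ = (if 0 ≤ δ + δE then gp δ else gm δ) + s * I * δ)
    (Ip Im : ℝ)
    (hIp : Ip = max (-δE) 0 + vB / (K * LA)
      + (γB * K * LA)⁻¹
        * Real.log ((G * (hA * LA + s) + s * I) / (G * lam * γB * K * hA * LA)))
    (hIm : Im = -(max δE 0) + vB / (K * LB)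
      + (γB * K * LB)⁻¹
        * Real.log ((G * (hB * LB + s) + s * I) / (G * lam * γB * K * hB * LB))) :
    Continuous Gt ∧
    gp (-δE) = gm (-δE) ∧
    Filter.Tendsto Gt Filter.atTop Filter.atBot ∧
    Filter.Tendsto Gt Filter.atBot Filter.atBot ∧
    (∃ δ0 : ℝ, ∀ δ : ℝ, Gt δ ≤ Gt δ0) ∧
    (∀ δm : ℝ, (∀ δ : ℝ, Gt δ ≤ Gt δm) → δm = Ip ∨ δm = Im ∨ δm = -δE) := by
  obtain ⟨cp, hcp⟩ : ∃ cp, ∀ δ, gp δ + s * I * δ = cp + (G * (hA * LA + s) + s * I) * δ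
      - (G * lam * hA) * Real.exp ((γB * K * LA) * δ
        + (-γB * vB - γB * K * LA * max (-δE) 0)) := by
    refine ⟨G * (hΔ * vA + α + (hB * LB - hA * LA) * max (-δE) 0
      + lam * hB * UB (vB - LB * K * max (-δE) 0)), fun δ => ?_⟩
    rw [hgp, hUB (vB - LA * K * (δ - max (-δE) 0)),
      show -γB * (vB - LA * K * (δ - max (-δE) 0)) = (γB * K * LA) * δ
        + (-γB * vB - γB * K * LA * max (-δE) 0) by ring]
    ring
  obtain ⟨cm, hcm⟩ : ∃ cm, ∀ δ, gm δ + s * I * δ = cm + (G * (hB * LB + s) + s * I) * δ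
      - (G * lam * hB) * Real.exp ((γB * K * LB) * δ
        + (-γB * vB + γB * K * LB * max δE 0)) := by
    refine ⟨G * (hΔ * vA + α + (hB * LB - hA * LA) * max δE 0
      + lam * hA * UB (vB + LA * K * max δE 0)), fun δ => ?_⟩
    rw [hgm, hUB (vB - LB * K * (δ + max δE 0)),
      show -γB * (vB - LB * K * (δ + max δE 0)) = (γB * K * LB) * δ
        + (-γB * vB + γB * K * LB * max δE 0) by ring]
    ring
  have heq : gp (-δE) = gm (-δE) := by
    rw [hgp, hgm]
    rcases le_total 0 δE with h | h
    · rw [max_eq_right (by linarith : -δE ≤ 0), max_eq_left h,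
        show vB - LA * K * (-δE - 0) = vB + LA * K * δE by ring,
        show vB - LB * K * (-δE + δE) = vB - LB * K * 0 by ring]
      ring
    · rw [max_eq_left (by linarith : 0 ≤ -δE), max_eq_right h,
        show vB - LA * K * (-δE - -δE) = vB + LA * K * 0 by ring,
        show vB - LB * K * (-δE + 0) = vB - LB * K * -δE by ring]
      ring
  have hGt1 : ∀ δ, 0 ≤ δ + δE → Gt δ = cp + (G * (hA * LA + s) + s * I) * δ
      - (G * lam * hA) * Real.exp ((γB * K * LA) * δ
        + (-γB * vB - γB * K * LA * max (-δE) 0)) := fun δ h => by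
    rw [hGt, if_pos h, hcp]
  have hGt2 : ∀ δ, δ + δE < 0 → Gt δ = cm + (G * (hB * LB + s) + s * I) * δ
      - (G * lam * hB) * Real.exp ((γB * K * LB) * δ
        + (-γB * vB + γB * K * LB * max δE 0)) := fun δ h => by
    rw [hGt, if_neg (not_le.mpr h), hcm]
  have hcont : Continuous Gt := by
    have e : Gt = fun δ => if 0 ≤ δ + δE then gp δ + s * I * δ else gm δ + s * I * δ := by
      funext δ; rw [hGt]; split_ifs <;> rfl
    rw [e]
    refine Continuous.if_le ?_ ?_ continuous_const (by fun_prop) ?_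
    · simp only [hcp]; fun_prop
    · simp only [hcm]; fun_prop
    · intro x hx
      obtain rfl : x = -δE := by linarith
      rw [heq]
  have htop : Filter.Tendsto Gt Filter.atTop Filter.atBot := by
    refine (aux_top cp (G * (hA * LA + s) + s * I) (G * lam * hA) (γB * K * LA)
      (-γB * vB - γB * K * LA * max (-δE) 0) hposA (by positivity)
      (by positivity)).congr' ?_
    filter_upwards [Filter.eventually_ge_atTop (-δE)] with x hx
    exact (hGt1 x (by linarith)).symm
  have hbot : Filter.Tendsto Gt Filter.atBot Filter.atBot := by
    refine (aux_bot cm (G * (hB * LB + s) + s * I) (G * lam * hB) (γB * K * LB)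
      (-γB * vB + γB * K * LB * max δE 0) hposB (by positivity)).congr' ?_
    filter_upwards [Filter.eventually_lt_atBot (-δE)] with x hx
    exact (hGt2 x (by linarith)).symm
  refine ⟨hcont, heq, htop, hbot, ?_, ?_⟩
  · apply hcont.exists_forall_ge
    rw [cocompact_eq_atBot_atTop]
    exact hbot.sup htop
  · intro x hx
    have hloc : IsLocalMax Gt x := Filter.Eventually.of_forall hx
    rcases lt_trichotomy x (-δE) with h | h | h
    · right; left
      have hev : Gt =ᶠ[nhds x] (fun δ => cm + (G * (hB * LB + s) + s * I) * δ
          - (G * lam * hB) * Real.exp ((γB * K * LB) * δ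
          + (-γB * vB + γB * K * LB * max δE 0))) := by
        filter_upwards [Iio_mem_nhds h] with y hy
        exact hGt2 y (by have := Set.mem_Iio.mp hy; linarith)
      rw [aux_crit _ _ _ _ _ x hposB (by positivity) (by positivity)
        (hloc.congr hev), hIm,
        show G * lam * hB * (γB * K * LB) = G * lam * γB * K * hB * LB by ring]
      generalize Real.log _ = l
      field_simp
      ring
    · right; right; exact h
    · left
      have hev : Gt =ᶠ[nhds x] (fun δ => cp + (G * (hA * LA + s) + s * I) * δ
          - (G * lam * hA) * Real.exp ((γB * K * LA) * δ
          + (-γB * vB - γB * K * LA * max (-δE) 0))) := by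
        filter_upwards [Ioi_mem_nhds h] with y hy
        exact hGt1 y (by have := Set.mem_Ioi.mp hy; linarith)
      rw [aux_crit _ _ _ _ _ x hposA (by positivity) (by positivity)
        (hloc.congr hev), hIp,
        show G * lam * hA * (γB * K * LA) = G * lam * γB * K * hA * LA by ring]
      generalize Real.log _ = l
      field_simp
      ring
end
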